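/- arXiv:1507.05605 — 10 statements merged into one kernel-verified Lean document; each statement's English description precedes it below -/
import Mathlib

section
/- For all reals p and q with 0 < q < p < 1, the quantity ω = (log(1−q) − log(1−p)) / (log p − log q + log(1−q) − log(1−p)) satisfies q < ω < p. -/
/-- A strict form of `log x ≤ x - 1`, cleared of denominators. -/
theorem mul_log_sub_log_lt_sub {a b : ℝ} (ha : 0 < a) (hb : 0 < b) (hab : a ≠ b) :
    a * (Real.log b - Real.log a) < b - a := by
  have hne : b / a ≠ 1 := fun h => hab ((div_eq_one_iff_eq ha.ne').mp h).symm
  have h := Real.log_lt_sub_one_of_pos (div_pos hb ha) hne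
  rw [Real.log_div hb.ne' ha.ne'] at h
  calc a * (Real.log b - Real.log a) < a * (b / a - 1) := mul_lt_mul_of_pos_left h ha
    _ = b - a := by field_simp

/-- Gibbs' inequality for two distinct Bernoulli distributions. -/
theorem bernoulli_gibbs_lt {a b : ℝ} (ha : 0 < a) (ha' : a < 1) (hb : 0 < b) (hb' : b < 1)
    (hab : a ≠ b) :
    a * (Real.log b - Real.log a) + (1 - a) * (Real.log (1 - b) - Real.log (1 - a)) < 0 := by
  have h₁ := mul_log_sub_log_lt_sub ha hb hab
  have h₂ := mul_log_sub_log_lt_sub (sub_pos.mpr ha') (sub_pos.mpr hb')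
    (fun h => hab (sub_right_injective h))
  linarith

/-- For all reals `p`, `q` with `0 < q < p < 1`, the quantity
`ω = (log(1−q) − log(1−p)) / (log p − log q + log(1−q) − log(1−p))`
satisfies `q < ω < p`. -/
theorem omega_bounds (p q : ℝ) (hq : 0 < q) (hqp : q < p) (hp : p < 1) :
    q < (Real.log (1 - q) - Real.log (1 - p)) /
        (Real.log p - Real.log q + Real.log (1 - q) - Real.log (1 - p)) ∧
    (Real.log (1 - q) - Real.log (1 - p)) /
        (Real.log p - Real.log q + Real.log (1 - q) - Real.log (1 - p)) < p := by
  have hA : Real.log q < Real.log p := Real.log_lt_log hq hqp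
  have hB : Real.log (1 - p) < Real.log (1 - q) := Real.log_lt_log (by linarith) (by linarith)
  have hqp_gibbs := bernoulli_gibbs_lt hq (hqp.trans hp) (hq.trans hqp) hp hqp.ne
  have hpq_gibbs := bernoulli_gibbs_lt (hq.trans hqp) hp hq (hqp.trans hp) hqp.ne'
  constructor
  · rw [lt_div_iff₀ (by linarith)]
    linarith
  · rw [div_lt_iff₀ (by linarith)]
    linarith
end

section
/- For reals p̃ > q̃ > 0 and α, β > 0, the planted-partition Chernoff–Hellinger divergence satisfies the closed form D₊(α,β) = α·q̃ + β·p̃ − γ + (1/2)·τ·(α−β)·log( (β·p̃)/(α·q̃) · (τ(α−β)+γ)/(τ(β−α)+γ) ), where τ = (p̃−q̃)/(log p̃ − log q̃) and γ = √(τ²(α−β)² + 4αβ·p̃·q̃). -/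
/-- The planted-partition Chernoff–Hellinger divergence:
`D₊(α,β) = sup_{t ∈ [0,1]} [α(t·p̃ + (1−t)·q̃ − p̃^t·q̃^(1−t)) + β(t·q̃ + (1−t)·p̃ − q̃^t·p̃^(1−t))]`. -/
noncomputable def Dplus (p q a b : ℝ) : ℝ :=
  sSup ((fun t : ℝ =>
      a * (t * p + (1 - t) * q - p ^ t * q ^ (1 - t)) +
      b * (t * q + (1 - t) * p - q ^ t * p ^ (1 - t))) '' Set.Icc 0 1)

/-- `τ = (p̃−q̃)/(log p̃ − log q̃)`. -/
noncomputable def tauPP (p q : ℝ) : ℝ := (p - q) / (Real.log p - Real.log q)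

/-- `γ = √(τ²(α−β)² + 4αβ·p̃·q̃)`. -/
noncomputable def gammaPP (p q a b : ℝ) : ℝ :=
  Real.sqrt ((tauPP p q) ^ 2 * (a - b) ^ 2 + 4 * a * b * p * q)

/-- Tangent-line bound for `u * e^s + v * e^(-s)` at a point `s₀` where its derivative is `d`. -/
theorem le_mul_exp_add_mul_exp_neg {u v d s₀ : ℝ} (hu : 0 ≤ u) (hv : 0 ≤ v)
    (hd : u * Real.exp s₀ - v * Real.exp (-s₀) = d) (s : ℝ) :
    u * Real.exp s₀ + v * Real.exp (-s₀) + d * (s - s₀) ≤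
      u * Real.exp s + v * Real.exp (-s) := by
  have h1 : Real.exp s₀ * (s - s₀ + 1) ≤ Real.exp s := by
    have := mul_le_mul_of_nonneg_left (Real.add_one_le_exp (s - s₀)) (Real.exp_pos s₀).le
    rwa [← Real.exp_add, add_sub_cancel] at this
  have h2 : Real.exp (-s₀) * (-(s - s₀) + 1) ≤ Real.exp (-s) := by
    have := mul_le_mul_of_nonneg_left (Real.add_one_le_exp (-(s - s₀))) (Real.exp_pos (-s₀)).le
    rwa [← Real.exp_add, show -s₀ + -(s - s₀) = -s by ring] at this
  have h3 := mul_le_mul_of_nonneg_left h1 hu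
  have h4 := mul_le_mul_of_nonneg_left h2 hv
  rw [← hd]
  linarith

/-- The map `x ↦ u * x - v / x` reflects the order on positive reals. -/
theorem le_of_mul_sub_div_le {u v x y : ℝ} (hu : 0 < u) (hv : 0 < v) (hy : 0 < y)
    (h : u * x - v / x ≤ u * y - v / y) : x ≤ y := by
  by_contra! hlt
  have h1 : u * y < u * x := mul_lt_mul_of_pos_left hlt hu
  have h2 : v / x < v / y := div_lt_div_of_pos_left hv hy hlt
  linarith

/-- The logarithmic mean of `q < p` lies between `q` and `p`. -/
theorem tauPP_mem_Icc {p q : ℝ} (hq : 0 < q) (hqp : q < p) : tauPP p q ∈ Set.Icc q p := by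
  have hp : 0 < p := hq.trans hqp
  have hL : 0 < Real.log p - Real.log q := sub_pos.2 (Real.log_lt_log hq hqp)
  have h1 := Real.log_le_sub_one_of_pos (div_pos hp hq)
  have h2 := Real.log_le_sub_one_of_pos (div_pos hq hp)
  rw [Real.log_div hp.ne' hq.ne', div_sub_one hq.ne', le_div_iff₀ hq] at h1
  rw [Real.log_div hq.ne' hp.ne', div_sub_one hp.ne', le_div_iff₀ hp] at h2
  refine ⟨(le_div_iff₀ hL).2 (by linarith), (div_le_iff₀ hL).2 (by linarith)⟩

/-- The objective of `Dplus`, written with exponentials. -/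
theorem Dplus_objective_eq {p q : ℝ} (hq : 0 < q) (hqp : q < p) (a b t : ℝ) :
    a * (t * p + (1 - t) * q - p ^ t * q ^ (1 - t)) +
        b * (t * q + (1 - t) * p - q ^ t * p ^ (1 - t)) =
      a * q + b * p + tauPP p q * (a - b) * (t * (Real.log p - Real.log q)) -
        (a * q * Real.exp (t * (Real.log p - Real.log q)) +
          b * p * Real.exp (-(t * (Real.log p - Real.log q)))) := by
  have hp : 0 < p := hq.trans hqp
  have hL : Real.log p - Real.log q ≠ 0 := (sub_pos.2 (Real.log_lt_log hq hqp)).ne'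
  have h1 : p ^ t * q ^ (1 - t) = q * Real.exp (t * (Real.log p - Real.log q)) := by
    rw [Real.rpow_def_of_pos hp, Real.rpow_def_of_pos hq, ← Real.exp_add]
    nth_rw 2 [← Real.exp_log hq]
    rw [← Real.exp_add]
    ring_nf
  have h2 : q ^ t * p ^ (1 - t) = p * Real.exp (-(t * (Real.log p - Real.log q))) := by
    rw [Real.rpow_def_of_pos hp, Real.rpow_def_of_pos hq, ← Real.exp_add]
    nth_rw 2 [← Real.exp_log hp]
    rw [← Real.exp_add]
    ring_nf
  have h3 : tauPP p q * (Real.log p - Real.log q) = p - q := div_mul_cancel₀ _ hL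
  rw [h1, h2]
  linear_combination (-(a - b) * t) * h3

/-- Closed form for the planted-partition Chernoff–Hellinger divergence. -/
theorem Dplus_closed_form (p q a b : ℝ) (hq : 0 < q) (hqp : q < p)
    (ha : 0 < a) (hb : 0 < b) :
    Dplus p q a b =
      a * q + b * p - gammaPP p q a b +
        (1 / 2) * tauPP p q * (a - b) *
          Real.log ((b * p) / (a * q) *
            ((tauPP p q * (a - b) + gammaPP p q a b) /
             (tauPP p q * (b - a) + gammaPP p q a b))) := by
  have hp : 0 < p := hq.trans hqp
  have hL : 0 < Real.log p - Real.log q := sub_pos.2 (Real.log_lt_log hq hqp)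
  obtain ⟨hτq, hτp⟩ := tauPP_mem_Icc hq hqp
  have hab : 0 < 4 * a * b * p * q := by positivity
  have hγsq : gammaPP p q a b ^ 2 = (tauPP p q * (a - b)) ^ 2 + 4 * a * b * p * q := by
    rw [gammaPP, Real.sq_sqrt (by positivity), mul_pow]
  have hγabs : |tauPP p q * (a - b)| < gammaPP p q a b :=
    abs_lt_of_sq_lt_sq (by linarith) (Real.sqrt_nonneg _)
  have hobj := Dplus_objective_eq hq hqp a b
  set τ := tauPP p q
  set γ := gammaPP p q a b
  obtain ⟨hneg, hpos⟩ := abs_lt.1 hγabs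
  have hN : 0 < τ * (a - b) + γ := by linarith
  have hM : 0 < τ * (b - a) + γ := by linarith
  have hNM : (τ * (a - b) + γ) * (τ * (b - a) + γ) = 4 * a * b * p * q := by
    linear_combination hγsq
  have hu : 0 < a * q := mul_pos ha hq
  have hv : 0 < b * p := mul_pos hb hp
  obtain ⟨x, hx⟩ : ∃ x, x = (τ * (a - b) + γ) / (2 * (a * q)) := ⟨_, rfl⟩
  have hx0 : 0 < x := hx ▸ by positivity
  have hux : a * q * x = (τ * (a - b) + γ) / 2 := by rw [hx]; field_simp
  have hvx : b * p / x = (τ * (b - a) + γ) / 2 := by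
    rw [hx]
    field_simp
    linear_combination -hNM
  have hcrit : a * q * x - b * p / x = τ * (a - b) := by rw [hux, hvx]; ring
  have hval : a * q * x + b * p / x = γ := by rw [hux, hvx]; ring
  have hlog : Real.log (b * p / (a * q) * ((τ * (a - b) + γ) / (τ * (b - a) + γ))) =
      2 * Real.log x := by
    have : b * p / (a * q) * ((τ * (a - b) + γ) / (τ * (b - a) + γ)) = x ^ 2 := by
      rw [hx]
      field_simp
      linear_combination -hNM
    rw [this, Real.log_pow, Nat.cast_ofNat]
  have h1x : 1 ≤ x := by
    refine le_of_mul_sub_div_le hu hv hx0 ?_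
    rw [hcrit]
    nlinarith
  have hxr : x ≤ p / q := by
    refine le_of_mul_sub_div_le hu hv (div_pos hp hq) ?_
    have : a * q * (p / q) - b * p / (p / q) = a * p - b * q := by field_simp
    rw [hcrit, this]
    nlinarith
  have hexp : Real.exp (Real.log x) = x := Real.exp_log hx0
  have hexpn : b * p * Real.exp (-Real.log x) = b * p / x := by
    rw [Real.exp_neg, hexp, div_eq_mul_inv]
  rw [hlog]
  refine IsGreatest.csSup_eq ⟨⟨Real.log x / (Real.log p - Real.log q), ⟨?_, ?_⟩, ?_⟩, ?_⟩
  · exact div_nonneg (Real.log_nonneg h1x) hL.le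
  · rw [div_le_one hL, ← Real.log_div hp.ne' hq.ne']
    exact Real.log_le_log hx0 hxr
  · simp only [hobj]
    rw [div_mul_cancel₀ _ hL.ne', hexp, hexpn, hval]
    ring
  · rintro _ ⟨t, -, rfl⟩
    simp only [hobj]
    have := le_mul_exp_add_mul_exp_neg hu.le hv.le (s₀ := Real.log x) (d := τ * (a - b))
      (by rw [hexp, hexpn, hcrit]) (t * (Real.log p - Real.log q))
    rw [hexp, hexpn, hval] at this
    linarith
end

section
/- For p̃ > q̃ > 0, the supremum over t ∈ [0,1] of (1/2)(t·p̃ + (1−t)·q̃ − p̃^t·q̃^(1−t)) + (1/2)(t·q̃ + (1−t)·p̃ − q̃^t·p̃^(1−t)) equals (1/2)(√p̃ − √q̃)², and this supremum is attained at t = 1/2. In particular, for two equal-sized communities the divergence condition D₊ > 1 is equivalent to √p̃ − √q̃ > √2. -/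
/-- AM–GM for the two conjugate weighted geometric means of `p` and `q`. -/
lemma two_mul_sqrt_mul_sqrt_le_rpow_add_rpow {p q : ℝ} (hp : 0 < p) (hq : 0 < q) (t : ℝ) :
    2 * (√p * √q) ≤ p ^ t * q ^ (1 - t) + q ^ t * p ^ (1 - t) := by
  have hprod : (p ^ t * q ^ (1 - t)) * (q ^ t * p ^ (1 - t)) = p * q := by
    have h1 : p ^ t * p ^ (1 - t) = p := by
      rw [← Real.rpow_add hp, add_sub_cancel, Real.rpow_one]
    have h2 : q ^ t * q ^ (1 - t) = q := by
      rw [← Real.rpow_add hq, add_sub_cancel, Real.rpow_one]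
    calc _ = (p ^ t * p ^ (1 - t)) * (q ^ t * q ^ (1 - t)) := by ring
      _ = p * q := by rw [h1, h2]
  refine (sq_le_sq₀ (by positivity) (by positivity)).mp ?_
  rw [mul_pow, mul_pow, Real.sq_sqrt hp.le, Real.sq_sqrt hq.le]
  nlinarith [sq_nonneg (p ^ t * q ^ (1 - t) - q ^ t * p ^ (1 - t))]

/-- For two equal-sized communities (`α = β = 1/2`), the CH-divergence equals
`(1/2)(√p̃ − √q̃)²`, the supremum is attained at `t = 1/2`, and the divergence
condition `D₊ > 1` is equivalent to `√p̃ − √q̃ > √2`. -/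
theorem Dplus_equal_sizes (p q : ℝ) (hq : 0 < q) (hqp : q < p) :
    Dplus p q (1/2) (1/2) = (1/2) * (Real.sqrt p - Real.sqrt q) ^ 2 ∧
    (1/2 : ℝ) * ((1/2) * p + (1 - 1/2) * q - p ^ (1/2 : ℝ) * q ^ (1 - 1/2 : ℝ)) +
      (1/2 : ℝ) * ((1/2) * q + (1 - 1/2) * p - q ^ (1/2 : ℝ) * p ^ (1 - 1/2 : ℝ)) =
      (1/2) * (Real.sqrt p - Real.sqrt q) ^ 2 ∧
    (1 < Dplus p q (1/2) (1/2) ↔ Real.sqrt 2 < Real.sqrt p - Real.sqrt q) := by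
  have hp : 0 < p := hq.trans hqp
  have hsp := Real.sq_sqrt hp.le
  have hsq := Real.sq_sqrt hq.le
  have hhalf : (1 - 1/2 : ℝ) = 1/2 := by norm_num
  have hval : (1/2 : ℝ) * ((1/2) * p + (1 - 1/2) * q - p ^ (1/2 : ℝ) * q ^ (1 - 1/2 : ℝ)) +
      (1/2 : ℝ) * ((1/2) * q + (1 - 1/2) * p - q ^ (1/2 : ℝ) * p ^ (1 - 1/2 : ℝ)) =
      (1/2) * (Real.sqrt p - Real.sqrt q) ^ 2 := by
    rw [hhalf, ← Real.sqrt_eq_rpow, ← Real.sqrt_eq_rpow]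
    linear_combination -(1/2) * hsp - (1/2) * hsq
  have hD : Dplus p q (1/2) (1/2) = (1/2) * (Real.sqrt p - Real.sqrt q) ^ 2 := by
    refine IsGreatest.csSup_eq ⟨⟨1/2, by norm_num, hval⟩, ?_⟩
    rintro _ ⟨t, -, rfl⟩
    dsimp only
    linarith [two_mul_sqrt_mul_sqrt_le_rpow_add_rpow hp hq t, sub_sq √p √q]
  refine ⟨hD, hval, ?_⟩
  rw [hD, Real.sqrt_lt' (sub_pos.mpr (Real.sqrt_lt_sqrt hq.le hqp))]
  constructor <;> intro h <;> linarith
end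

section
/- Let X be an n×n real matrix such that every column of X lies in the span of {1_{S_i} − 1_{S_j} : i ≠ j}, X_{uu} = 1 for every vertex u, and X_{uv} = −1/(r−1) whenever u and v lie in different communities. Then X equals the centered partition matrix X̂. -/
/-- The centered partition matrix of the partition induced by the community
assignment `σ : Fin n → Fin r`. -/
noncomputable def centeredPartitionMatrix (n r : ℕ) (σ : Fin n → Fin r) :
    Matrix (Fin n) (Fin n) ℝ :=
  Matrix.of fun u v => if σ u = σ v then 1 else -1 / ((r : ℝ) - 1)

/-- The indicator vector `1_{S_i} ∈ ℝⁿ` of community `i`. -/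
def communityIndicator (n r : ℕ) (σ : Fin n → Fin r) (i : Fin r) : Fin n → ℝ :=
  fun u => if σ u = i then 1 else 0

/-- Vectors in the span of the differences of community indicators are constant on communities. -/
theorem apply_eq_of_mem_span_communityIndicator_sub {n r : ℕ} {σ : Fin n → Fin r}
    {x : Fin n → ℝ}
    (hx : x ∈ Submodule.span ℝ {w : Fin n → ℝ |
      ∃ i j : Fin r, i ≠ j ∧ w = communityIndicator n r σ i - communityIndicator n r σ j})
    {u v : Fin n} (h : σ u = σ v) : x u = x v := by
  induction hx using Submodule.span_induction with
  | mem w hw =>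
    obtain ⟨i, j, -, rfl⟩ := hw
    simp [communityIndicator, h]
  | zero => rfl
  | add y z _ _ hy hz => simp [hy, hz]
  | smul a y _ hy => simp [hy]

/-- If every column of `X` lies in `span{1_{S_i} − 1_{S_j} : i ≠ j}`, the diagonal
entries of `X` are `1`, and `X_{uv} = −1/(r−1)` whenever `u,v` lie in different
communities, then `X` is the centered partition matrix. -/
theorem eq_centeredPartitionMatrix (n r : ℕ) (hn : 1 ≤ n) (hr : 2 ≤ r)
    (σ : Fin n → Fin r) (hσ : Function.Surjective σ)
    (X : Matrix (Fin n) (Fin n) ℝ)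
    (hcol : ∀ v : Fin n, (fun u => X u v) ∈
      Submodule.span ℝ {w : Fin n → ℝ |
        ∃ i j : Fin r, i ≠ j ∧ w = communityIndicator n r σ i - communityIndicator n r σ j})
    (hdiag : ∀ u : Fin n, X u u = 1)
    (hoff : ∀ u v : Fin n, σ u ≠ σ v → X u v = -1 / ((r : ℝ) - 1)) :
    X = centeredPartitionMatrix n r σ := by
  ext u v
  by_cases h : σ u = σ v
  · have huv : X u v = X v v := apply_eq_of_mem_span_communityIndicator_sub (hcol v) h
    simp [centeredPartitionMatrix, h, huv, hdiag]
  · simp [centeredPartitionMatrix, h, hoff u v h]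
end

section
/- Let A be an adjacency matrix such that the centered partition matrix X̂ is the unique maximizer of ⟨A,X⟩ over the known-sizes feasible region. If A′ is obtained from A by a monotone change, then X̂ is the unique maximizer of ⟨A′,X⟩ over the known-sizes feasible region. -/
open Finset

/-- The Frobenius inner product `⟨A,X⟩ = Σ_{u,v} A_{uv} X_{uv}`. -/
noncomputable def frobInner {n : ℕ} (A X : Matrix (Fin n) (Fin n) ℝ) : ℝ :=
  ∑ u, ∑ v, A u v * X u v

/-- The size `s_i` of community `i`. -/
def communitySize (n r : ℕ) (σ : Fin n → Fin r) (i : Fin r) : ℕ :=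
  (Finset.univ.filter fun u => σ u = i).card

/-- The known-sizes feasible region: PSD matrices with unit diagonal, entries
at least `−1/(r−1)`, and `⟨J,X⟩ = (r/(r−1))·Σ_i s_i² − n²/(r−1)`. -/
def feasKnown (n r : ℕ) (σ : Fin n → Fin r) : Set (Matrix (Fin n) (Fin n) ℝ) :=
  {X | X.PosSemidef ∧ (∀ u, X u u = 1) ∧ (∀ u v, -1 / ((r : ℝ) - 1) ≤ X u v) ∧
    (∑ u, ∑ v, X u v) =
      ((r : ℝ) / ((r : ℝ) - 1)) * (∑ i : Fin r, ((communitySize n r σ i : ℝ)) ^ 2) -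
        (n : ℝ) ^ 2 / ((r : ℝ) - 1)}

/-- An adjacency matrix: symmetric, `{0,1}`-valued, zero diagonal. -/
def IsAdjacency {n : ℕ} (A : Matrix (Fin n) (Fin n) ℝ) : Prop :=
  A.IsSymm ∧ (∀ u v, A u v = 0 ∨ A u v = 1) ∧ (∀ u, A u u = 0)

/-- A single monotone change with respect to the ground-truth partition `σ`:
`A'` agrees with `A` except at one symmetric pair of entries, where either an
edge is added within a community, or an edge is removed between communities. -/
def MonotoneChange {n r : ℕ} (σ : Fin n → Fin r)
    (A A' : Matrix (Fin n) (Fin n) ℝ) : Prop :=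
  ∃ u v : Fin n, u ≠ v ∧
    (∀ a b : Fin n, ¬(a = u ∧ b = v) → ¬(a = v ∧ b = u) → A' a b = A a b) ∧
    ((σ u = σ v ∧ A u v = 0 ∧ A v u = 0 ∧ A' u v = 1 ∧ A' v u = 1) ∨
     (σ u ≠ σ v ∧ A u v = 1 ∧ A v u = 1 ∧ A' u v = 0 ∧ A' v u = 0))

theorem Matrix.PosSemidef.apply_le_one {n : Type*} {X : Matrix n n ℝ}
    (hX : X.PosSemidef) (hdiag : ∀ u, X u u = 1) (a b : n) : X a b ≤ 1 := by
  have hdet := (hX.submatrix ![a, b]).det_nonneg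
  have hsymm : X b a = X a b := by simpa using hX.isHermitian.apply a b
  rw [Matrix.det_fin_two] at hdet
  simp [hdiag, hsymm] at hdet
  nlinarith

/-- Robustness of the known-sizes SDP to a monotone change: if the centered
partition matrix is the unique maximizer of `⟨A,X⟩` over the known-sizes
feasible region, it remains so after a monotone change of `A`. -/
theorem knownSizes_robust (n r : ℕ) (hn : 1 ≤ n) (hr : 2 ≤ r)
    (σ : Fin n → Fin r) (hσ : Function.Surjective σ)
    (A A' : Matrix (Fin n) (Fin n) ℝ)
    (hA : IsAdjacency A) (hA' : IsAdjacency A')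
    (hchange : MonotoneChange σ A A')
    (hfeas : centeredPartitionMatrix n r σ ∈ feasKnown n r σ)
    (hopt : ∀ X ∈ feasKnown n r σ, X ≠ centeredPartitionMatrix n r σ →
      frobInner A X < frobInner A (centeredPartitionMatrix n r σ)) :
    centeredPartitionMatrix n r σ ∈ feasKnown n r σ ∧
    ∀ X ∈ feasKnown n r σ, X ≠ centeredPartitionMatrix n r σ →
      frobInner A' X < frobInner A' (centeredPartitionMatrix n r σ) := by
  refine ⟨hfeas, fun X hX hne => ?_⟩
  have hlt := hopt X hX hne
  obtain ⟨hpsd, hdiag, hlow, -⟩ := hX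
  have hle : ∀ a b, (A' a b - A a b) * X a b ≤
      (A' a b - A a b) * centeredPartitionMatrix n r σ a b := by
    intro a b
    have h1 := hpsd.apply_le_one hdiag a b
    have h2 := hlow a b
    obtain ⟨u, v, -, heq, hcase⟩ := hchange
    by_cases huv : a = u ∧ b = v
    · obtain ⟨rfl, rfl⟩ := huv
      rcases hcase with ⟨hs, h, -, h', -⟩ | ⟨hs, h, -, h', -⟩ 
      · simpa [centeredPartitionMatrix, hs, h, h'] using h1
      · simpa [centeredPartitionMatrix, hs, h, h'] using h2
    by_cases hvu : a = v ∧ b = u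
    · obtain ⟨rfl, rfl⟩ := hvu
      rcases hcase with ⟨hs, -, h, -, h'⟩ | ⟨hs, -, h, -, h'⟩
      · simpa [centeredPartitionMatrix, hs, h, h'] using h1
      · simpa [centeredPartitionMatrix, Ne.symm hs, h, h'] using h2
    simp [heq a b huv hvu]
  have hsum := Finset.sum_le_sum fun a (_ : a ∈ Finset.univ) =>
    Finset.sum_le_sum fun b (_ : b ∈ Finset.univ) => hle a b
  simp only [sub_mul, Finset.sum_sub_distrib] at hsum
  unfold frobInner at hlt ⊢
  linarith
end

section
/- Fix a real number ω. Let A be an adjacency matrix such that the centered partition matrix X̂ is the unique maximizer of ⟨A,X⟩ − ω·⟨J,X⟩ over the unknown-sizes feasible region. If A′ is obtained from A by a monotone change, then X̂ is the unique maximizer of ⟨A′,X⟩ − ω·⟨J,X⟩ over the unknown-sizes feasible region. -/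
open Finset

/-- The unknown-sizes feasible region: PSD matrices with unit diagonal and
entries at least `−1/(r−1)`. -/
def feasUnknown (n r : ℕ) : Set (Matrix (Fin n) (Fin n) ℝ) :=
  {X | X.PosSemidef ∧ (∀ u, X u u = 1) ∧ (∀ u v, -1 / ((r : ℝ) - 1) ≤ X u v)}

/-- Off-diagonal entries of a positive semidefinite matrix with unit diagonal are at most `1`. -/
theorem entry_le_one_of_posSemidef {n : ℕ} {X : Matrix (Fin n) (Fin n) ℝ} (hX : X.PosSemidef)
    (hdiag : ∀ u, X u u = 1) (u v : Fin n) : X u v ≤ 1 := by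
  have hsymm : X v u = X u v := by simpa using hX.isHermitian.apply u v
  have h := hX.dotProduct_mulVec_nonneg (Pi.single u 1 - Pi.single v 1)
  simp [Matrix.mulVec_sub, sub_dotProduct, dotProduct_sub, hdiag, hsymm] at h
  linarith

/-- A monotone change shifts each term of the objective in favour of the centered partition
matrix. -/
theorem MonotoneChange.entry_le {n r : ℕ} {σ : Fin n → Fin r}
    {A A' X : Matrix (Fin n) (Fin n) ℝ} (hchange : MonotoneChange σ A A')
    (hX : X ∈ feasUnknown n r) (a b : Fin n) :
    (A' a b - A a b) * X a b ≤ (A' a b - A a b) * centeredPartitionMatrix n r σ a b := by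
  obtain ⟨hpsd, hdiag, hlow⟩ := hX
  have hle := entry_le_one_of_posSemidef hpsd hdiag a b
  have hge := hlow a b
  obtain ⟨u, v, -, hsame, hcase⟩ := hchange
  by_cases huv : a = u ∧ b = v
  · obtain ⟨rfl, rfl⟩ := huv
    rcases hcase with ⟨hσ, h1, h2, h3, h4⟩ | ⟨hσ, h1, h2, h3, h4⟩ <;>
      simp only [centeredPartitionMatrix, Matrix.of_apply, hσ, if_true, if_false, h1, h3] <;>
      linarith
  by_cases hvu : a = v ∧ b = u
  · obtain ⟨rfl, rfl⟩ := hvu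
    rcases hcase with ⟨hσ, h1, h2, h3, h4⟩ | ⟨hσ, h1, h2, h3, h4⟩ <;>
      simp only [centeredPartitionMatrix, Matrix.of_apply, eq_comm (a := σ a), hσ, if_true, if_false,
        h2, h4] <;>
      linarith
  simp [hsame a b huv hvu]

theorem frobInner_sub_left {n : ℕ} (A B X : Matrix (Fin n) (Fin n) ℝ) :
    frobInner (A - B) X = frobInner A X - frobInner B X := by
  simp [frobInner, sub_mul, Finset.sum_sub_distrib]

/-- Robustness of the unknown-sizes SDP to a monotone change: if the centered
partition matrix is the unique maximizer of `⟨A,X⟩ − ω⟨J,X⟩` over the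
unknown-sizes feasible region, it remains so after a monotone change of `A`. -/
theorem unknownSizes_robust (n r : ℕ) (hn : 1 ≤ n) (hr : 2 ≤ r)
    (σ : Fin n → Fin r) (hσ : Function.Surjective σ) (ω : ℝ)
    (A A' : Matrix (Fin n) (Fin n) ℝ)
    (hA : IsAdjacency A) (hA' : IsAdjacency A')
    (hchange : MonotoneChange σ A A')
    (hfeas : centeredPartitionMatrix n r σ ∈ feasUnknown n r)
    (hopt : ∀ X ∈ feasUnknown n r, X ≠ centeredPartitionMatrix n r σ →
      frobInner A X - ω * (∑ u, ∑ v, X u v) <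
        frobInner A (centeredPartitionMatrix n r σ) -
          ω * (∑ u, ∑ v, centeredPartitionMatrix n r σ u v)) :
    centeredPartitionMatrix n r σ ∈ feasUnknown n r ∧
    ∀ X ∈ feasUnknown n r, X ≠ centeredPartitionMatrix n r σ →
      frobInner A' X - ω * (∑ u, ∑ v, X u v) <
        frobInner A' (centeredPartitionMatrix n r σ) -
          ω * (∑ u, ∑ v, centeredPartitionMatrix n r σ u v) := by
  refine ⟨hfeas, fun X hX hne => ?_⟩
  have hshift : frobInner (A' - A) X ≤ frobInner (A' - A) (centeredPartitionMatrix n r σ) :=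
    Finset.sum_le_sum fun a _ => Finset.sum_le_sum fun b _ => hchange.entry_le hX a b
  rw [frobInner_sub_left, frobInner_sub_left] at hshift
  linarith [hopt X hX hne]
end

section
/- (Weak duality.) Let A be a symmetric n×n real matrix, ω ∈ ℝ, ν ∈ ℝⁿ, and let Γ be a symmetric n×n matrix with all entries nonnegative such that Λ := diag(ν) + ω·J − A − Γ is positive semidefinite. Then for every matrix X in the unknown-sizes feasible region, ⟨A,X⟩ − ω·⟨J,X⟩ ≤ Σ_v ν_v + (1/(r−1))·⟨J,Γ⟩. -/
open Finset

/-- The Frobenius inner product of two positive semidefinite matrices is nonnegative. -/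
theorem frobInner_nonneg {n : ℕ} {A X : Matrix (Fin n) (Fin n) ℝ}
    (hA : A.PosSemidef) (hX : X.PosSemidef) : 0 ≤ frobInner A X := by
  simpa [frobInner, dotProduct, Matrix.mulVec] using
    (hA.hadamard hX).dotProduct_mulVec_nonneg (fun _ => 1)

/-- Weak duality: if `ν, Γ` are dual feasible (`Γ ≥ 0` entrywise, symmetric, and
`Λ = diag(ν) + ωJ − A − Γ ⪰ 0`), then for every `X` in the unknown-sizes feasible
region, `⟨A,X⟩ − ω⟨J,X⟩ ≤ Σ_v ν_v + (1/(r−1))⟨J,Γ⟩`. -/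
theorem weak_duality (n r : ℕ) (hn : 1 ≤ n) (hr : 2 ≤ r)
    (A Γ : Matrix (Fin n) (Fin n) ℝ) (ω : ℝ) (ν : Fin n → ℝ)
    (hA : A.IsSymm) (hΓsymm : Γ.IsSymm) (hΓnonneg : ∀ u v, 0 ≤ Γ u v)
    (hΛ : (Matrix.diagonal ν + ω • (Matrix.of fun _ _ : Fin n => (1 : ℝ)) - A - Γ).PosSemidef) :
    ∀ X ∈ feasUnknown n r,
      frobInner A X - ω * (∑ u, ∑ v, X u v) ≤
        (∑ v, ν v) + (1 / ((r : ℝ) - 1)) * (∑ u, ∑ v, Γ u v) := by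
  rintro X ⟨hX, hdiag, hlower⟩
  have hΛX := frobInner_nonneg hΛ hX
  have hexpand : frobInner
      (Matrix.diagonal ν + ω • (Matrix.of fun _ _ : Fin n => (1 : ℝ)) - A - Γ) X =
      (∑ v, ν v) + ω * (∑ u, ∑ v, X u v) - frobInner A X - frobInner Γ X := by
    simp [frobInner, Matrix.diagonal_apply, add_mul, sub_mul, sum_add_distrib,
      sum_sub_distrib, mul_sum, hdiag]
  have hΓX : -(1 / ((r : ℝ) - 1)) * (∑ u, ∑ v, Γ u v) ≤ frobInner Γ X := by
    simp only [frobInner, mul_sum]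
    refine sum_le_sum fun u _ => sum_le_sum fun v _ => ?_
    rw [mul_comm, ← neg_div]
    exact mul_le_mul_of_nonneg_left (hlower u v) (hΓnonneg u v)
  linarith
end

section
/- (Dual certificate, known sizes.) Let A be a symmetric n×n real matrix and ω ∈ ℝ. Suppose there exist ν ∈ ℝⁿ and a symmetric n×n matrix Γ such that, setting Λ := diag(ν) + ω·J − A − Γ: (i) Λ is positive semidefinite; (ii) Γ_{uv} = 0 whenever u and v lie in the same community; (iii) Γ_{uv} > 0 whenever u and v lie in different communities; (iv) the kernel of Λ, viewed as a linear map ℝⁿ → ℝⁿ, equals the span of {1_{S_i} − 1_{S_j} : i ≠ j}. Then the centered partition matrix X̂ is the unique maximizer of ⟨A,X⟩ over the known-sizes feasible region. -/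
open Finset

/-- The centered indicator vectors of the communities: row `i` is `1_{S_i} − (1/r)·1`. -/
noncomputable def centeredIndicator (n r : ℕ) (σ : Fin n → Fin r) :
    Matrix (Fin r) (Fin n) ℝ :=
  Matrix.of fun i u => communityIndicator n r σ i u - 1 / (r : ℝ)

theorem centeredPartitionMatrix_eq_smul (n r : ℕ) (hr : 2 ≤ r) (σ : Fin n → Fin r) :
    centeredPartitionMatrix n r σ =
      ((r : ℝ) / ((r : ℝ) - 1)) •
        ((centeredIndicator n r σ).transpose * centeredIndicator n r σ) := by
  have h2 : (2 : ℝ) ≤ r := by exact_mod_cast hr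
  have h0 : (r : ℝ) ≠ 0 := by positivity
  have h1 : (r : ℝ) - 1 ≠ 0 := by linarith
  ext u v
  simp only [centeredPartitionMatrix, centeredIndicator, communityIndicator, Matrix.of_apply,
    Matrix.smul_apply, Matrix.mul_apply, Matrix.transpose_apply, smul_eq_mul, sub_mul, mul_sub,
    Finset.sum_sub_distrib, ite_mul, one_mul, zero_mul, mul_ite, mul_one, mul_zero,
    Finset.sum_ite_eq, Finset.mem_univ, if_true, Finset.sum_const, Finset.card_univ,
    Fintype.card_fin, nsmul_eq_mul]
  by_cases h : σ u = σ v
  · rw [if_pos h, if_pos h]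
    field_simp
    ring
  · rw [if_neg h, if_neg h]
    field_simp
    ring

theorem centeredIndicator_mem_span (n r : ℕ) (hr : 2 ≤ r) (σ : Fin n → Fin r) (i : Fin r) :
    centeredIndicator n r σ i ∈ Submodule.span ℝ {w : Fin n → ℝ |
      ∃ i j : Fin r, i ≠ j ∧ w = communityIndicator n r σ i - communityIndicator n r σ j} := by
  have h0 : (r : ℝ) ≠ 0 := by positivity
  have key : centeredIndicator n r σ i =
      ((1 : ℝ) / r) • ∑ j, (communityIndicator n r σ i - communityIndicator n r σ j) := by
    ext u
    simp only [centeredIndicator, communityIndicator, Matrix.of_apply, Pi.smul_apply,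
      Finset.sum_apply, Pi.sub_apply, Finset.sum_sub_distrib, Finset.sum_const, Finset.card_univ,
      Fintype.card_fin, nsmul_eq_mul, Finset.sum_ite_eq, Finset.mem_univ, if_true, smul_eq_mul, Pi.mul_apply,
      Pi.natCast_apply]
    field_simp
  rw [key]
  refine Submodule.smul_mem _ _ (Submodule.sum_mem _ fun j _ => ?_)
  by_cases hij : i = j
  · rw [hij, sub_self]
    exact Submodule.zero_mem _
  · exact Submodule.subset_span ⟨i, j, hij, rfl⟩

theorem eq_of_mem_span_indicator_sub {n r : ℕ} {σ : Fin n → Fin r} {w : Fin n → ℝ}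
    (hw : w ∈ Submodule.span ℝ {w : Fin n → ℝ |
      ∃ i j : Fin r, i ≠ j ∧ w = communityIndicator n r σ i - communityIndicator n r σ j})
    {u v : Fin n} (h : σ u = σ v) : w u = w v := by
  induction hw using Submodule.span_induction with
  | mem x hx =>
    obtain ⟨i, j, -, rfl⟩ := hx
    simp [communityIndicator, h]
  | zero => rfl
  | add x y _ _ hx hy => simp [hx, hy]
  | smul a x _ hx => simp [hx]

theorem frobInner_transpose_mul_self {n : ℕ} {κ : Type*} [Fintype κ]
    (L : Matrix (Fin n) (Fin n) ℝ) (B : Matrix κ (Fin n) ℝ) :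
    frobInner L (B.transpose * B) = ∑ k, B k ⬝ᵥ (L.mulVec (B k)) := by
  simp only [frobInner, Matrix.mul_apply, Matrix.transpose_apply, dotProduct, Matrix.mulVec,
    Finset.mul_sum]
  simp_rw [Finset.sum_comm (s := (Finset.univ : Finset (Fin n))) (t := (Finset.univ : Finset κ))]
  refine Finset.sum_congr rfl fun k _ => ?_
  refine Finset.sum_congr rfl fun u _ => Finset.sum_congr rfl fun v _ => ?_
  ring

theorem sum_centeredPartitionMatrix (n r : ℕ) (hr : 2 ≤ r) (σ : Fin n → Fin r) :
    ∑ u, ∑ v, centeredPartitionMatrix n r σ u v =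
      ((r : ℝ) / ((r : ℝ) - 1)) * (∑ i : Fin r, ((communitySize n r σ i : ℝ)) ^ 2) -
        (n : ℝ) ^ 2 / ((r : ℝ) - 1) := by
  have h2 : (2 : ℝ) ≤ r := by exact_mod_cast hr
  have h1 : (r : ℝ) - 1 ≠ 0 := by linarith
  have hsize (i : Fin r) : (communitySize n r σ i : ℝ) = ∑ u, if σ u = i then (1 : ℝ) else 0 := by
    simp [communitySize]
  have hsq : ∑ i : Fin r, ((communitySize n r σ i : ℝ)) ^ 2 =
      ∑ u, ∑ v, if σ u = σ v then (1 : ℝ) else 0 := by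
    simp_rw [hsize, sq, Finset.sum_mul_sum]
    rw [Finset.sum_comm]
    refine Finset.sum_congr rfl fun u _ => ?_
    rw [Finset.sum_comm]
    refine Finset.sum_congr rfl fun v _ => ?_
    simp [eq_comm]
  have hentry (u v : Fin n) : centeredPartitionMatrix n r σ u v =
      ((r : ℝ) / ((r : ℝ) - 1)) * (if σ u = σ v then (1 : ℝ) else 0) - 1 / ((r : ℝ) - 1) := by
    rw [centeredPartitionMatrix, Matrix.of_apply]
    split_ifs <;> field_simp
    ring
  simp_rw [hentry, Finset.sum_sub_distrib, ← Finset.mul_sum, ← hsq]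
  simp
  ring

theorem centeredPartitionMatrix_mem_feasKnown (n r : ℕ) (hr : 2 ≤ r) (σ : Fin n → Fin r) :
    centeredPartitionMatrix n r σ ∈ feasKnown n r σ := by
  have h2 : (2 : ℝ) ≤ r := by exact_mod_cast hr
  have h1 : (0 : ℝ) < (r : ℝ) - 1 := by linarith
  refine ⟨?_, fun u => by simp [centeredPartitionMatrix], fun u v => ?_,
    sum_centeredPartitionMatrix n r hr σ⟩
  · rw [centeredPartitionMatrix_eq_smul n r hr σ, ← Matrix.conjTranspose_eq_transpose_of_trivial]
    exact (Matrix.posSemidef_conjTranspose_mul_self _).smul (by positivity)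
  · have hneg : -1 / ((r : ℝ) - 1) ≤ 0 := div_nonpos_of_nonpos_of_nonneg (by norm_num) h1.le
    rw [centeredPartitionMatrix, Matrix.of_apply]
    split_ifs <;> linarith

/-- The duality identity: on unit-diagonal matrices the objective is a function of `⟨J,X⟩`
and the two slack terms. -/
theorem frobInner_certificate {n : ℕ} (A Γ X : Matrix (Fin n) (Fin n) ℝ) (ω : ℝ)
    (ν : Fin n → ℝ) (hX : ∀ u, X u u = 1) :
    frobInner A X = ∑ u, ν u + ω * (∑ u, ∑ v, X u v) - frobInner Γ X -
      frobInner (Matrix.diagonal ν + ω • (Matrix.of fun _ _ : Fin n => (1 : ℝ)) - A - Γ) X := by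
  simp only [frobInner, Matrix.sub_apply, Matrix.add_apply, Matrix.smul_apply, Matrix.of_apply,
    Matrix.diagonal_apply, sub_mul, add_mul, Finset.sum_sub_distrib, Finset.sum_add_distrib,
    ite_mul, zero_mul, Finset.sum_ite_eq, Finset.mem_univ, if_true, hX, smul_eq_mul, mul_one,
    Finset.mul_sum]
  ring

open scoped MatrixOrder Matrix.Norms.L2Operator in
theorem exists_eq_transpose_mul_self {ι : Type*} [Fintype ι] [DecidableEq ι]
    {X : Matrix ι ι ℝ} (hX : X.PosSemidef) : ∃ B : Matrix ι ι ℝ, X = B.transpose * B := by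
  obtain ⟨B, hB⟩ := CStarAlgebra.nonneg_iff_eq_star_mul_self.mp hX.nonneg
  exact ⟨B, by rw [hB, Matrix.star_eq_conjTranspose, Matrix.conjTranspose_eq_transpose_of_trivial]⟩

/-- Dual certificate for the known-sizes SDP: if there exist `ν, Γ` with
`Λ = diag(ν) + ωJ − A − Γ ⪰ 0`, `Γ` vanishing on diagonal blocks, strictly
positive on off-diagonal blocks, and `ker Λ = span{1_{S_i} − 1_{S_j}}`, then the
centered partition matrix is the unique maximizer of `⟨A,X⟩` over the
known-sizes feasible region. -/
theorem dual_certificate_known_sizes (n r : ℕ) (hn : 1 ≤ n) (hr : 2 ≤ r)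
    (σ : Fin n → Fin r) (hσ : Function.Surjective σ)
    (A Γ : Matrix (Fin n) (Fin n) ℝ) (ω : ℝ) (ν : Fin n → ℝ)
    (hA : A.IsSymm) (hΓsymm : Γ.IsSymm)
    (hΛpsd : (Matrix.diagonal ν + ω • (Matrix.of fun _ _ : Fin n => (1 : ℝ)) - A - Γ).PosSemidef)
    (hΓ0 : ∀ u v : Fin n, σ u = σ v → Γ u v = 0)
    (hΓpos : ∀ u v : Fin n, σ u ≠ σ v → 0 < Γ u v)
    (hker : LinearMap.ker
        (Matrix.diagonal ν + ω • (Matrix.of fun _ _ : Fin n => (1 : ℝ)) - A - Γ).mulVecLin =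
      Submodule.span ℝ {w : Fin n → ℝ |
        ∃ i j : Fin r, i ≠ j ∧ w = communityIndicator n r σ i - communityIndicator n r σ j}) :
    centeredPartitionMatrix n r σ ∈ feasKnown n r σ ∧
    ∀ X ∈ feasKnown n r σ, X ≠ centeredPartitionMatrix n r σ →
      frobInner A X < frobInner A (centeredPartitionMatrix n r σ) := by
  have hmem := centeredPartitionMatrix_mem_feasKnown n r hr σ
  refine ⟨hmem, fun X hX hne => ?_⟩
  obtain ⟨hXpsd, hXdiag, hXge, hXsum⟩ := hX
  have hid := frobInner_certificate A Γ X ω ν hXdiag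
  have hid' := frobInner_certificate A Γ _ ω ν hmem.2.1
  set L := Matrix.diagonal ν + ω • (Matrix.of fun _ _ : Fin n => (1 : ℝ)) - A - Γ
  rw [hXsum] at hid
  rw [hmem.2.2.2] at hid'
  have hslack : frobInner L (centeredPartitionMatrix n r σ) = 0 := by
    have hrow (i : Fin r) : L.mulVec (centeredIndicator n r σ i) = 0 := by
      have := centeredIndicator_mem_span n r hr σ i
      rwa [← hker] at this
    have h : frobInner L ((centeredIndicator n r σ).transpose * centeredIndicator n r σ) = 0 := by
      simp [frobInner_transpose_mul_self, hrow]
    rw [centeredPartitionMatrix_eq_smul n r hr σ]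
    simp only [frobInner, Matrix.smul_apply, smul_eq_mul, mul_left_comm (_ : ℝ) ((r : ℝ) / _),
      ← Finset.mul_sum] at h ⊢
    rw [h, mul_zero]
  obtain ⟨B, hB⟩ := exists_eq_transpose_mul_self hXpsd
  have hnonneg (k : Fin n) : 0 ≤ B k ⬝ᵥ L.mulVec (B k) := by
    simpa using hΛpsd.dotProduct_mulVec_nonneg (B k)
  have hLX : frobInner L X = ∑ k, B k ⬝ᵥ L.mulVec (B k) := by
    rw [hB, frobInner_transpose_mul_self]
  have hLX0 : 0 ≤ frobInner L X := hLX ▸ Finset.sum_nonneg fun k _ => hnonneg k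
  have hterm (u v : Fin n) : Γ u v * centeredPartitionMatrix n r σ u v ≤ Γ u v * X u v := by
    by_cases h : σ u = σ v
    · simp [hΓ0 u v h]
    · refine mul_le_mul_of_nonneg_left ?_ (hΓpos u v h).le
      simpa [centeredPartitionMatrix, h] using hXge u v
  have hΓX : frobInner Γ (centeredPartitionMatrix n r σ) ≤ frobInner Γ X :=
    Finset.sum_le_sum fun u _ => Finset.sum_le_sum fun v _ => hterm u v
  by_contra! hle
  have hLX_zero : frobInner L X = 0 := by linarith
  have hΓ_eq : frobInner Γ (centeredPartitionMatrix n r σ) = frobInner Γ X := by linarith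
  apply hne
  ext u v
  by_cases h : σ u = σ v
  · have hrow (k : Fin n) : B k u = B k v := by
      have hk := (Finset.sum_eq_zero_iff_of_nonneg fun k _ => hnonneg k).mp
        (hLX.symm.trans hLX_zero) k (Finset.mem_univ k)
      have hk' : L.mulVec (B k) = 0 :=
        (hΛpsd.dotProduct_mulVec_zero_iff (B k)).mp (by simpa using hk)
      have hk'' : B k ∈ LinearMap.ker L.mulVecLin := hk'
      rw [hker] at hk''
      exact eq_of_mem_span_indicator_sub hk'' h
    have huv : X u v = X v v := by
      simp [hB, Matrix.mul_apply, hrow]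
    simp [huv, hXdiag, centeredPartitionMatrix, h]
  · have hsum := (Finset.sum_eq_sum_iff_of_le fun u _ =>
      Finset.sum_le_sum fun v _ => hterm u v).mp hΓ_eq u (Finset.mem_univ u)
    have hentry := (Finset.sum_eq_sum_iff_of_le fun v _ => hterm u v).mp hsum v
      (Finset.mem_univ v)
    exact (mul_left_cancel₀ (hΓpos u v h).ne' hentry).symm
end

section
/- Let A be a symmetric n×n real matrix, ω ∈ ℝ, ν ∈ ℝⁿ, and let Γ be a symmetric n×n matrix with Γ_{uv} = 0 whenever u and v lie in the same community; set Λ := diag(ν) + ω·J − A − Γ and, for a vertex u and community j, E(u,j) := Σ_{v ∈ S_j} A_{uv}. Then the span of {1_{S_i} − 1_{S_j} : i ≠ j} is contained in the kernel of Λ if and only if for every pair of distinct communities i ≠ j and every vertex u ∈ S_i one has ν_u + ω(s_i − s_j) − E(u,i) + E(u,j) + Σ_{v ∈ S_j} Γ_{uv} = 0. -/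
open Finset

/-- `E(u,j) = Σ_{v ∈ S_j} A_{uv}`, the number of edges from `u` into community `j`. -/
noncomputable def edgesTo {n r : ℕ} (A : Matrix (Fin n) (Fin n) ℝ) (σ : Fin n → Fin r)
    (u : Fin n) (j : Fin r) : ℝ :=
  ∑ v ∈ Finset.univ.filter fun v => σ v = j, A u v

/-- The entry at `u` of `(diag(ν) + ωJ − A − Γ) 1_{S_k}`. -/
theorem mulVec_communityIndicator_apply {n r : ℕ} (σ : Fin n → Fin r)
    (A Γ : Matrix (Fin n) (Fin n) ℝ) (ω : ℝ) (ν : Fin n → ℝ) (k : Fin r) (u : Fin n) :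
    ((Matrix.diagonal ν + ω • (Matrix.of fun _ _ : Fin n => (1 : ℝ)) - A - Γ).mulVec
        (communityIndicator n r σ k)) u =
      (if σ u = k then ν u else 0) + ω * (communitySize n r σ k : ℝ) - edgesTo A σ u k -
        ∑ v ∈ Finset.univ.filter fun v => σ v = k, Γ u v := by
  have hJ : (Matrix.of fun _ _ : Fin n => (1 : ℝ)).mulVec (communityIndicator n r σ k) u =
      (communitySize n r σ k : ℝ) := by
    simp [Matrix.mulVec, dotProduct, communityIndicator, communitySize]
  have hM (M : Matrix (Fin n) (Fin n) ℝ) : M.mulVec (communityIndicator n r σ k) u =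
      ∑ v ∈ Finset.univ.filter fun v => σ v = k, M u v := by
    simp [Matrix.mulVec, dotProduct, communityIndicator, Finset.sum_filter]
  rw [Matrix.sub_mulVec, Matrix.sub_mulVec, Matrix.add_mulVec, Matrix.smul_mulVec]
  simp only [Pi.sub_apply, Pi.add_apply, Pi.smul_apply, hJ, hM A, hM Γ, Matrix.mulVec_diagonal,
    smul_eq_mul, edgesTo]
  simp [communityIndicator]

/-- With `Λ = diag(ν) + ωJ − A − Γ` and `Γ` vanishing on diagonal blocks, the span
of `{1_{S_i} − 1_{S_j} : i ≠ j}` is contained in `ker Λ` iff for all communities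
`i ≠ j` and all `u ∈ S_i`,
`ν_u + ω(s_i − s_j) − E(u,i) + E(u,j) + Σ_{v ∈ S_j} Γ_{uv} = 0`. -/
theorem kernel_span_iff_cs1 (n r : ℕ) (hn : 1 ≤ n) (hr : 2 ≤ r)
    (σ : Fin n → Fin r) (hσ : Function.Surjective σ)
    (A Γ : Matrix (Fin n) (Fin n) ℝ) (ω : ℝ) (ν : Fin n → ℝ)
    (hA : A.IsSymm) (hΓsymm : Γ.IsSymm)
    (hΓ0 : ∀ u v : Fin n, σ u = σ v → Γ u v = 0) :
    (Submodule.span ℝ {w : Fin n → ℝ |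
        ∃ i j : Fin r, i ≠ j ∧ w = communityIndicator n r σ i - communityIndicator n r σ j} ≤
      LinearMap.ker
        (Matrix.diagonal ν + ω • (Matrix.of fun _ _ : Fin n => (1 : ℝ)) - A - Γ).mulVecLin) ↔
    (∀ i j : Fin r, i ≠ j → ∀ u : Fin n, σ u = i →
      ν u + ω * ((communitySize n r σ i : ℝ) - (communitySize n r σ j : ℝ)) -
        edgesTo A σ u i + edgesTo A σ u j +
        (∑ v ∈ Finset.univ.filter fun v => σ v = j, Γ u v) = 0) := by
  have hΓ (u : Fin n) : ∑ v ∈ Finset.univ.filter fun v => σ v = σ u, Γ u v = 0 :=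
    Finset.sum_eq_zero fun v hv => hΓ0 u v (Finset.mem_filter.mp hv).2.symm
  rw [Submodule.span_le]
  constructor
  · rintro h i j hij u rfl
    have hu := congrFun (LinearMap.mem_ker.mp (h ⟨σ u, j, hij, rfl⟩)) u
    rw [Matrix.mulVecLin_apply, Matrix.mulVec_sub, Pi.sub_apply,
      mulVec_communityIndicator_apply, mulVec_communityIndicator_apply, if_pos rfl,
      if_neg hij, hΓ, Pi.zero_apply] at hu
    linarith
  · rintro h _ ⟨i, j, -, rfl⟩
    have key (k : Fin r) (u : Fin n) :
        (if σ u = k then ν u else 0) + ω * (communitySize n r σ k : ℝ) - edgesTo A σ u k -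
            ∑ v ∈ Finset.univ.filter fun v => σ v = k, Γ u v =
          ν u + ω * (communitySize n r σ (σ u) : ℝ) - edgesTo A σ u (σ u) := by
      by_cases hk : σ u = k
      · subst hk
        rw [if_pos rfl, hΓ, sub_zero]
      · rw [if_neg hk]
        linarith [h (σ u) k hk u rfl]
    refine LinearMap.mem_ker.mpr (funext fun u => ?_)
    rw [Matrix.mulVecLin_apply, Matrix.mulVec_sub, Pi.sub_apply,
      mulVec_communityIndicator_apply, mulVec_communityIndicator_apply, key, key, sub_self,
      Pi.zero_apply]
end

section
/- For all reals 0 < q̃ < p̃, setting τ = (p̃ − q̃)/(log p̃ − log q̃), one has −p̃·q̃/τ + (p̃·log(p̃/τ) − q̃·log(q̃/τ))/(log p̃ − log q̃) ≥ 0. -/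
/-- The geometric mean of two positive reals is at most their logarithmic mean. -/
theorem sqrt_mul_log_sub_le {p q : ℝ} (hq : 0 < q) (hqp : q < p) :
    √p * √q * (Real.log p - Real.log q) ≤ p - q := by
  have hp : 0 < p := hq.trans hqp
  have hsp := Real.sqrt_pos.2 hp
  have hsq := Real.sqrt_pos.2 hq
  have hlog : Real.log (√p / √q) = (Real.log p - Real.log q) / 2 := by
    rw [Real.log_div hsp.ne' hsq.ne', Real.log_sqrt hp.le, Real.log_sqrt hq.le]
    ring
  have hnonneg : 0 ≤ Real.log (√p / √q) := by
    have := Real.log_lt_log hq hqp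
    rw [hlog]
    linarith
  have hsinh := Real.self_le_sinh_iff.2 hnonneg
  rw [Real.sinh_log (div_pos hsp hsq), hlog, inv_div] at hsinh
  have hmul := mul_le_mul_of_nonneg_left hsinh (by positivity : 0 ≤ 2 * (√p * √q))
  have heq : 2 * (√p * √q) * ((√p / √q - √q / √p) / 2) = p - q := by
    field_simp
    rw [Real.sq_sqrt hp.le, Real.sq_sqrt hq.le]
  linarith

/-- The tangent-line bound `log τ + 1 - τ / t ≤ log t`, integrated over `t ∈ [q, p]`. -/
theorem sub_mul_log_add_le {p q τ : ℝ} (hq : 0 < q) (hqp : q ≤ p) (hτ : 0 < τ) :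
    (p - q) * (Real.log τ + 2) - τ * (Real.log p - Real.log q) ≤
      p * Real.log p - q * Real.log q := by
  let f : ℝ → ℝ := fun t => t * Real.log t - t * (Real.log τ + 2) + τ * Real.log t
  have hderiv : ∀ t, 0 < t → HasDerivAt f (Real.log t - Real.log τ - 1 + τ / t) t := by
    intro t ht
    refine (((Real.hasDerivAt_mul_log ht.ne').sub
      ((hasDerivAt_id t).mul_const (Real.log τ + 2))).add
        ((Real.hasDerivAt_log ht.ne').const_mul τ)).congr_deriv ?_
    ring
  have hmono : MonotoneOn f (Set.Ioi 0) := by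
    refine monotoneOn_of_hasDerivWithinAt_nonneg (convex_Ioi 0)
      (fun t ht => (hderiv t ht).continuousAt.continuousWithinAt)
      (fun t ht => (hderiv t (interior_subset ht)).hasDerivWithinAt) fun t ht => ?_
    have ht : 0 < t := interior_subset ht
    have := Real.log_le_sub_one_of_pos (div_pos hτ ht)
    rw [Real.log_div hτ.ne' ht.ne'] at this
    linarith
  have := hmono (Set.mem_Ioi.2 hq) (Set.mem_Ioi.2 (hq.trans_le hqp)) hqp
  simp only [f] at this
  linarith

/-- For `0 < q̃ < p̃` and `τ = (p̃−q̃)/(log p̃ − log q̃)`, the limit as `s → 0⁺`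
of `∂η/∂s` for the closed-form CH-divergence is nonnegative:
`−p̃q̃/τ + (p̃·log(p̃/τ) − q̃·log(q̃/τ))/(log p̃ − log q̃) ≥ 0`. -/
theorem deriv_limit_nonneg (p q : ℝ) (hq : 0 < q) (hqp : q < p) :
    0 ≤ -p * q / ((p - q) / (Real.log p - Real.log q)) +
        (p * Real.log (p / ((p - q) / (Real.log p - Real.log q))) -
          q * Real.log (q / ((p - q) / (Real.log p - Real.log q)))) /
        (Real.log p - Real.log q) := by
  have hp : 0 < p := hq.trans hqp
  have hL : 0 < Real.log p - Real.log q := sub_pos.2 (Real.log_lt_log hq hqp)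
  have hd : 0 < p - q := sub_pos.2 hqp
  have hgeom := sqrt_mul_log_sub_le hq hqp
  set L := Real.log p - Real.log q
  have hτ : 0 < (p - q) / L := div_pos hd hL
  have hident := sub_mul_log_add_le hq hqp.le hτ
  have hτL : (p - q) / L * L = p - q := div_mul_cancel₀ _ hL.ne'
  rw [Real.log_div hp.ne' hτ.ne', Real.log_div hq.ne' hτ.ne']
  set τ := (p - q) / L
  have hmean : √p * √q ≤ τ := (le_div_iff₀ hL).2 hgeom
  have hsq : p * q ≤ τ * τ := by
    calc p * q = (√p * √q) * (√p * √q) := by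
          rw [mul_mul_mul_comm, Real.mul_self_sqrt hp.le, Real.mul_self_sqrt hq.le]
      _ ≤ τ * τ := mul_self_le_mul_self (by positivity) hmean
  have hfirst : p * q / τ ≤ τ := (div_le_iff₀ hτ).2 hsq
  have hsecond : τ ≤ (p * (Real.log p - Real.log τ) - q * (Real.log q - Real.log τ)) / L := by
    rw [le_div_iff₀ hL, hτL]
    linarith
  rw [neg_mul, neg_div]
  linarith
end
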